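/- For all subsets C₁ ⊆ U₁, C₂ ⊆ U₂ and every ε > 0, one has (C₁ × C₂)_{uε} ⊆ (C₁)_{uε} × (C₂)_{uε} (uniform enlargements computed in U = U₁ × U₂ on the left and in U₁, U₂ on the right). Consequently, if 𝓒₁ and 𝓒₂ are polar uniformly enlargeable families of closed subsets of U₁ and U₂ respectively, then (𝓒₁ × 𝓒₂)°° is a polar uniformly enlargeable family of closed subsets of U₁ × U₂. -/

import Mathlib

open Set Metric

section Defs

variable {X : Type*} [MetricSpace X]

/-- `V` is open in the subspace topology of `U`. -/
def IsOpenIn (U V : Set X) : Prop := ∃ W, IsOpen W ∧ V = W ∩ U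

/-- `C` is closed in the subspace topology of `U`. -/
def IsClosedIn (U C : Set X) : Prop := ∃ F, IsClosed F ∧ C = F ∩ U

/-- Closure of `C` in the subspace topology of `U` (for `C ⊆ U`). -/
def closureIn (U C : Set X) : Set X := closure C ∩ U

/-- Interior of `S` in the subspace topology of `U`. -/
def interiorIn (U S : Set X) : Set X := U \ closure (U \ S)

/-- Polar of a family `𝓞` of open subsets of `U`:  closed subsets of `U` whose intersection with
every member of `𝓞` has compact closure in `U`. -/
def polarO (U : Set X) (𝓞 : Set (Set X)) : Set (Set X) :=
  {C | IsClosedIn U C ∧ ∀ W ∈ 𝓞, IsCompact (closureIn U (C ∩ W))}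

/-- Polar of a family `𝓒` of closed subsets of `U`: open subsets of `U` whose intersection with
every member of `𝓒` has compact closure in `U`. -/
def polarC (U : Set X) (𝓒 : Set (Set X)) : Set (Set X) :=
  {V | IsOpenIn U V ∧ ∀ C ∈ 𝓒, IsCompact (closureIn U (V ∩ C))}

/-- `𝓞_𝓒`: the family of relative interiors of members of `𝓒`. -/
def oFam (U : Set X) (𝓒 : Set (Set X)) : Set (Set X) := interiorIn U '' 𝓒

/-- `𝓒_𝓞`: the family of relative closures of members of `𝓞`. -/
def cFam (U : Set X) (𝓞 : Set (Set X)) : Set (Set X) := closureIn U '' 𝓞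

/-- Uniform `ε`-enlargement of `C ⊆ U`:
`C_{uε} = {x ∈ U : ∃ y ∈ C, d(x,y) ≤ min(ε, d(y,M∖U)·(1−e^{−ε})/2)}`, where the distance to the
(possibly empty) complement of `U` is taken in `[0,∞]`. -/
def uEnl (U C : Set X) (ε : ℝ) : Set X :=
  {x | x ∈ U ∧ ∃ y ∈ C, dist x y ≤ ε ∧
    ENNReal.ofReal (dist x y) ≤ EMetric.infEdist y Uᶜ * ENNReal.ofReal ((1 - Real.exp (-ε)) / 2)}

/-- A family of closed subsets of `U` is uniformly enlargeable if each member has some uniform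
`ε`-enlargement in the family. -/
def UniformlyEnlargeable (U : Set X) (𝓒 : Set (Set X)) : Prop :=
  ∀ C ∈ 𝓒, ∃ ε : ℝ, 0 < ε ∧ uEnl U C ε ∈ 𝓒

/-- The cover-dependent `ε`-enlargement `C_ε = ⋃ᵢ cl(Uᵢ) ∩ (cl(Uᵢ) ∩ C)_{uεᵢ}`. -/
def coverEnl {I : Type*} (Ui : I → Set X) (U C : Set X) (ε : I → ℝ) : Set X :=
  ⋃ i, closure (Ui i) ∩ uEnl U (closure (Ui i) ∩ C) (ε i)

/-- The cover-dependent enlargement `C_{wε} = ⋃ᵢ (cl(Uᵢ) ∩ C)_{uεᵢ}`. -/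
def coverWEnl {I : Type*} (Ui : I → Set X) (U C : Set X) (ε : I → ℝ) : Set X :=
  ⋃ i, uEnl U (closure (Ui i) ∩ C) (ε i)

/-- A family of closed subsets of `U` is enlargeable with respect to the cover `Ui` if each
member has some cover-enlargement in the family. -/
def Enlargeable {I : Type*} (Ui : I → Set X) (U : Set X) (𝓒 : Set (Set X)) : Prop :=
  ∀ C ∈ 𝓒, ∃ ε : I → ℝ, (∀ i, 0 < ε i) ∧ coverEnl Ui U C ε ∈ 𝓒

/-- A cover of `U` by open sets with compact closures contained in `U`, locally finite in `U`. -/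
structure GoodCover {I : Type*} (Ui : I → Set X) (U : Set X) : Prop where
  isOpen : ∀ i, IsOpen (Ui i)
  covers : U ⊆ ⋃ i, Ui i
  compactCl : ∀ i, IsCompact (closure (Ui i))
  clSubset : ∀ i, closure (Ui i) ⊆ U
  locFin : ∀ x ∈ U, ∃ t ∈ nhds x, {i | (closure (Ui i) ∩ t).Nonempty}.Finite

/-- `δ(t) = ln((1+e^{−t})/(3e^{−t}−1))`. -/
noncomputable def deltaFn (t : ℝ) : ℝ :=
  Real.log ((1 + Real.exp (-t)) / (3 * Real.exp (-t) - 1))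

end Defs

open Filter Topology in
theorem rc_iff {Z : Type*} [MetricSpace Z] (U A : Set Z) (hA : A ⊆ U) :
    IsCompact (closureIn U A) ↔
      ∀ a : ℕ → Z, (∀ k, a k ∈ A) → ∃ x ∈ U, ∃ φ : ℕ → ℕ, StrictMono φ ∧
        Tendsto (a ∘ φ) atTop (𝓝 x) := by
  constructor
  · intro h a ha
    obtain ⟨x, hx, φ, hφ, ht⟩ := h.isSeqCompact (x := a)
      (fun k => ⟨subset_closure (ha k), hA (ha k)⟩)
    exact ⟨x, hx.2, φ, hφ, ht⟩
  · intro h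
    apply IsSeqCompact.isCompact
    intro s hs
    have h1 : ∀ k : ℕ, ∃ a ∈ A, dist (s k) a < 1 / ((k : ℝ) + 1) := fun k =>
      Metric.mem_closure_iff.1 (hs k).1 _ (by positivity)
    choose a ha hd using h1
    obtain ⟨x, hx, φ, hφ, ht⟩ := h a ha
    refine ⟨x, ⟨mem_closure_of_tendsto ht (Eventually.of_forall fun k => ha _), hx⟩, φ, hφ, ?_⟩
    have h0 : Tendsto (fun k => dist ((a ∘ φ) k) ((s ∘ φ) k)) atTop (𝓝 0) := by
      refine squeeze_zero (fun _ => dist_nonneg) (fun k => ?_)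
        (tendsto_one_div_add_atTop_nhds_zero_nat.comp hφ.tendsto_atTop)
      rw [dist_comm]
      exact (hd (φ k)).le
    exact (tendsto_iff_of_dist h0).1 ht

theorem rc_mono {Z : Type*} [MetricSpace Z] {U A B : Set Z}
    (hAB : closureIn U A ⊆ closureIn U B) (hB : IsCompact (closureIn U B)) :
    IsCompact (closureIn U A) := by
  have : closureIn U A = closureIn U B ∩ closure A := by
    ext x
    constructor
    · intro hx
      exact ⟨hAB hx, hx.1⟩
    · intro hx
      exact ⟨hx.2, hx.1.2⟩
  rw [this]
  exact hB.inter_right isClosed_closure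

theorem closureIn_mono {Z : Type*} [MetricSpace Z] {U A B : Set Z} (h : A ⊆ B) :
    closureIn U A ⊆ closureIn U B :=
  inter_subset_inter_left _ (closure_mono h)

theorem rc_of_subset {Z : Type*} [MetricSpace Z] {U A K : Set Z} (hK : IsCompact K)
    (hKU : K ⊆ U) (hA : A ⊆ K) : IsCompact (closureIn U A) := by
  have h1 : closure A ⊆ K := closure_minimal hA hK.isClosed
  have : closureIn U A = closure A := inter_eq_left.2 (h1.trans hKU)
  rw [this]
  exact hK.of_isClosed_subset isClosed_closure h1

open Filter Topology in
theorem proj_mem {Z X : Type*} [MetricSpace Z] [ProperSpace Z] [MetricSpace X]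
    (p : Z → X) (hp : ∀ z w, dist (p z) (p w) ≤ dist z w)
    (U : Set Z) (hU : IsOpen U) (U₁ : Set X) (hU₁ : IsOpen U₁) (hpU : ∀ z ∈ U, p z ∈ U₁)
    (𝓢 : Set (Set Z)) (𝓒 : Set (Set X)) (h𝓒 : ∀ F ∈ 𝓒, F ⊆ U₁)
    (hS : ∀ S ∈ 𝓢, ∃ F ∈ 𝓒, ∀ z ∈ S, p z ∈ F)
    (C : Set Z) (hC : C ∈ polarO U (polarC U 𝓢)) :
    closureIn U₁ (p '' C) ∈ polarO U₁ (polarC U₁ 𝓒) := by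
  have hpc : Continuous p :=
    (LipschitzWith.of_dist_le_mul (K := 1) (by simpa using hp)).continuous
  obtain ⟨⟨F₀, hF₀, hCF⟩, hC2⟩ := hC
  have hCU : C ⊆ U := by rw [hCF]; exact inter_subset_right
  refine ⟨⟨closure (p '' C), isClosed_closure, rfl⟩, ?_⟩
  rintro W₁ ⟨⟨W', hW', hWe⟩, hW₁⟩
  have hWo : IsOpen W₁ := hWe ▸ hW'.inter hU₁
  have hWU : W₁ ⊆ U₁ := hWe ▸ inter_subset_right
  have key : IsCompact (closureIn U₁ (p '' C ∩ W₁)) := by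
    rw [rc_iff _ _ (fun x hx => hWU hx.2)]
    by_contra hcon
    push Not at hcon
    obtain ⟨a, ha, hno⟩ := hcon
    have h1 : ∀ k, ∃ c ∈ C, p c = a k := fun k => (ha k).1
    choose c hc hpa using h1
    have hOo : IsOpen (U ∩ p ⁻¹' W₁) := hU.inter (hWo.preimage hpc)
    have h2 : ∀ k : ℕ, ∃ r : ℝ, 0 < r ∧ r ≤ 1 / ((k : ℝ) + 1) ∧
        closedBall (c k) r ⊆ U ∩ p ⁻¹' W₁ := by
      intro k
      have hm : c k ∈ U ∩ p ⁻¹' W₁ := ⟨hCU (hc k), by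
        show p (c k) ∈ W₁
        rw [hpa]; exact (ha k).2⟩
      obtain ⟨r, hr, hb⟩ := Metric.nhds_basis_closedBall.mem_iff.1 (hOo.mem_nhds hm)
      exact ⟨min r (1 / ((k : ℝ) + 1)), lt_min hr (by positivity), min_le_right _ _,
        (closedBall_subset_closedBall (min_le_left _ _)).trans hb⟩
    choose r hr0 hr1 hrb using h2
    have hWU' : (⋃ k, ball (c k) (r k)) ⊆ U := iUnion_subset fun k =>
      (ball_subset_closedBall.trans (hrb k)).trans inter_subset_left
    have hW : (⋃ k, ball (c k) (r k)) ∈ polarC U 𝓢 := by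
      refine ⟨⟨_, isOpen_iUnion fun k => isOpen_ball, (inter_eq_left.2 hWU').symm⟩, ?_⟩
      intro S hSm
      obtain ⟨F, hF, hpF⟩ := hS S hSm
      have hrc := hW₁ F hF
      rw [rc_iff _ _ (fun x hx => hWU hx.1)] at hrc
      have hfin : ∃ K : ℕ, ∀ k ≥ K, ball (c k) (r k) ∩ S = ∅ := by
        by_contra hcon
        push Not at hcon
        have hfr : ∃ᶠ k in atTop, (ball (c k) (r k) ∩ S).Nonempty := by
          rw [frequently_atTop]
          intro K
          obtain ⟨k, hk, hne⟩ := hcon K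
          exact ⟨k, hk, hne⟩
        obtain ⟨φ, hφ, hne⟩ := extraction_of_frequently_atTop hfr
        choose z hz using hne
        obtain ⟨x, hx, ψ, hψ, ht⟩ := hrc (fun k => p (z k)) (fun k =>
          ⟨(hrb _ (ball_subset_closedBall (hz k).1)).2, hpF _ (hz k).2⟩)
        refine hno x hx (φ ∘ ψ) (hφ.comp hψ) ?_
        refine (tendsto_iff_of_dist ?_).1 ht
        refine squeeze_zero (fun _ => dist_nonneg) (fun k => ?_)
          (tendsto_one_div_add_atTop_nhds_zero_nat.comp (hφ.comp hψ).tendsto_atTop)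
        have h3 := hp (z (ψ k)) (c (φ (ψ k)))
        have h4 : dist (z (ψ k)) (c (φ (ψ k))) < r (φ (ψ k)) := (hz (ψ k)).1
        have h5 := hr1 (φ (ψ k))
        simp only [Function.comp_apply, ← hpa]
        linarith
      obtain ⟨K, hK⟩ := hfin
      refine rc_of_subset (K := ⋃ k ∈ Finset.range K, closedBall (c k) (r k))
        ((Finset.range K).isCompact_biUnion fun k _ => isCompact_closedBall _ _)
        (iUnion₂_subset fun k _ => (hrb k).trans inter_subset_left) ?_
      rintro z ⟨hz, hzS⟩
      obtain ⟨k, hk⟩ := mem_iUnion.1 hz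
      refine mem_iUnion₂.2 ⟨k, ?_, ball_subset_closedBall hk⟩
      rw [Finset.mem_range]
      by_contra hkK
      have := hK k (not_lt.1 hkK)
      exact (this ▸ (⟨hk, hzS⟩ : z ∈ ball (c k) (r k) ∩ S) : z ∈ (∅ : Set Z))
    have hfinal := hC2 _ hW
    rw [rc_iff _ _ (fun x hx => hCU hx.1)] at hfinal
    obtain ⟨x, hx, φ, hφ, ht⟩ := hfinal c (fun k =>
      ⟨hc k, mem_iUnion.2 ⟨k, mem_ball_self (hr0 k)⟩⟩)
    refine hno (p x) (hpU x hx) φ hφ ?_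
    have := (hpc.tendsto x).comp ht
    refine this.congr fun k => ?_
    simp [hpa]
  refine rc_mono ?_ key
  have : closureIn U₁ (p '' C) ∩ W₁ ⊆ closure (p '' C ∩ W₁) := fun x hx =>
    hWo.closure_inter ⟨hx.1.1, hx.2⟩
  exact inter_subset_inter_left _ (closure_minimal this isClosed_closure)

open Filter Topology in
theorem uEnl_closedIn {Z : Type*} [MetricSpace Z] [ProperSpace Z] (U : Set Z) (hU : IsOpen U)
    (C : Set Z) (hC : IsClosedIn U C) (ε : ℝ) : IsClosedIn U (uEnl U C ε) := by
  obtain ⟨F, hF, hCF⟩ := hC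
  refine ⟨closure (uEnl U C ε), isClosed_closure, Subset.antisymm
    (fun x hx => ⟨subset_closure hx, hx.1⟩) ?_⟩
  rintro x ⟨hx, hxU⟩
  obtain ⟨s, hs, hsx⟩ := mem_closure_iff_seq_limit.1 hx
  have h1 : ∀ k, ∃ y ∈ C, dist (s k) y ≤ ε ∧
    ENNReal.ofReal (dist (s k) y) ≤
      Metric.infEDist y Uᶜ * ENNReal.ofReal ((1 - Real.exp (-ε)) / 2) := fun k => (hs k).2
  choose y hyC hd he using h1
  obtain ⟨R, hR⟩ := (Metric.isBounded_range_of_tendsto s hsx).subset_closedBall x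
  have hyb : ∀ k, y k ∈ closedBall x (R + ε) := by
    intro k
    have h2 : dist (s k) x ≤ R := hR (mem_range_self k)
    have h3 := dist_triangle_left (y k) x (s k)
    rw [mem_closedBall]
    linarith [hd k]
  obtain ⟨y₀, -, φ, hφ, ht⟩ := (isCompact_closedBall x (R + ε)).isSeqCompact hyb
  have hsφ := hsx.comp hφ.tendsto_atTop
  have hdist : Tendsto (fun k => dist (s (φ k)) (y (φ k))) atTop (𝓝 (dist x y₀)) :=
    hsφ.dist ht
  have hd0 : dist x y₀ ≤ ε := le_of_tendsto hdist (Eventually.of_forall fun k => hd _)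
  have he0 : ENNReal.ofReal (dist x y₀) ≤
      Metric.infEDist y₀ Uᶜ * ENNReal.ofReal ((1 - Real.exp (-ε)) / 2) := by
    refine le_of_tendsto_of_tendsto (ENNReal.tendsto_ofReal hdist)
      (ENNReal.Tendsto.mul_const ((Metric.continuous_infEDist.tendsto y₀).comp ht)
        (Or.inr ENNReal.ofReal_ne_top)) (Eventually.of_forall fun k => he _)
  have hyU : y₀ ∈ U := by
    by_contra hn
    rw [Metric.infEDist_zero_of_mem (show y₀ ∈ Uᶜ from hn), zero_mul] at he0
    have : dist x y₀ ≤ 0 := ENNReal.ofReal_eq_zero.1 (le_antisymm he0 bot_le)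
    exact hn (dist_le_zero.1 this ▸ hxU)
  refine ⟨hxU, y₀, ?_, hd0, he0⟩
  rw [hCF]
  refine ⟨hF.mem_of_tendsto ht (Eventually.of_forall fun k => ?_), hyU⟩
  have := hyC (φ k)
  rw [hCF] at this
  exact this.1

theorem uEnl_mono {Z : Type*} [MetricSpace Z] {U C D : Set Z} (h : C ⊆ D) {ε δ : ℝ}
    (hε : ε ≤ δ) : uEnl U C ε ⊆ uEnl U D δ := by
  rintro x ⟨hx, y, hy, h1, h2⟩
  refine ⟨hx, y, h hy, h1.trans hε, h2.trans ?_⟩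
  gcongr

theorem uEnl_prod {X Y : Type*} [MetricSpace X] [MetricSpace Y] (U₁ : Set X) (U₂ : Set Y)
    (C₁ : Set X) (C₂ : Set Y) (ε : ℝ) :
    uEnl (U₁ ×ˢ U₂) (C₁ ×ˢ C₂) ε ⊆ (uEnl U₁ C₁ ε) ×ˢ (uEnl U₂ C₂ ε) := by
  rintro ⟨x₁, x₂⟩ ⟨⟨hx₁, hx₂⟩, ⟨y₁, y₂⟩, ⟨hy₁, hy₂⟩, hd, he⟩
  have hm₁ : dist x₁ y₁ ≤ dist (x₁, x₂) (y₁, y₂) := by rw [Prod.dist_eq]; exact le_max_left _ _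
  have hm₂ : dist x₂ y₂ ≤ dist (x₁, x₂) (y₁, y₂) := by rw [Prod.dist_eq]; exact le_max_right _ _
  have hi₁ : Metric.infEDist (y₁, y₂) (U₁ ×ˢ U₂)ᶜ ≤ Metric.infEDist y₁ U₁ᶜ := by
    refine Metric.le_infEDist.2 fun z hz => ?_
    refine (Metric.infEDist_le_edist_of_mem (y := (z, y₂)) (show (z, y₂) ∈ (U₁ ×ˢ U₂)ᶜ from fun h => hz h.1)).trans ?_
    simp [Prod.edist_eq]
  have hi₂ : Metric.infEDist (y₁, y₂) (U₁ ×ˢ U₂)ᶜ ≤ Metric.infEDist y₂ U₂ᶜ := by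
    refine Metric.le_infEDist.2 fun z hz => ?_
    refine (Metric.infEDist_le_edist_of_mem (y := (y₁, z)) (show (y₁, z) ∈ (U₁ ×ˢ U₂)ᶜ from fun h => hz h.2)).trans ?_
    simp [Prod.edist_eq]
  exact ⟨⟨hx₁, y₁, hy₁, hm₁.trans hd, (ENNReal.ofReal_le_ofReal hm₁).trans
      (he.trans (mul_le_mul_left hi₁ _))⟩,
    ⟨hx₂, y₂, hy₂, hm₂.trans hd, (ENNReal.ofReal_le_ofReal hm₂).trans
      (he.trans (mul_le_mul_left hi₂ _))⟩⟩

/-- uniform enlargements of products, and products of polar uniformly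
enlargeable families. -/
theorem stmt15 {X Y : Type*} [MetricSpace X] [ProperSpace X] [MetricSpace Y] [ProperSpace Y]
    (U₁ : Set X) (hU₁ : IsOpen U₁) (U₂ : Set Y) (hU₂ : IsOpen U₂) :
    (∀ (C₁ : Set X) (C₂ : Set Y), C₁ ⊆ U₁ → C₂ ⊆ U₂ → ∀ ε : ℝ, 0 < ε →
      uEnl (U₁ ×ˢ U₂) (C₁ ×ˢ C₂) ε ⊆ (uEnl U₁ C₁ ε) ×ˢ (uEnl U₂ C₂ ε)) ∧
    ∀ (𝓒₁ : Set (Set X)) (𝓒₂ : Set (Set Y)),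
      (∀ C ∈ 𝓒₁, IsClosedIn U₁ C) → 𝓒₁ = polarO U₁ (polarC U₁ 𝓒₁) →
        UniformlyEnlargeable U₁ 𝓒₁ →
      (∀ C ∈ 𝓒₂, IsClosedIn U₂ C) → 𝓒₂ = polarO U₂ (polarC U₂ 𝓒₂) →
        UniformlyEnlargeable U₂ 𝓒₂ →
      ((∀ F ∈ polarO (U₁ ×ˢ U₂)
            (polarC (U₁ ×ˢ U₂) {S | ∃ F₁ ∈ 𝓒₁, ∃ F₂ ∈ 𝓒₂, S = F₁ ×ˢ F₂}),
          IsClosedIn (U₁ ×ˢ U₂) F) ∧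
        UniformlyEnlargeable (U₁ ×ˢ U₂)
          (polarO (U₁ ×ˢ U₂)
            (polarC (U₁ ×ˢ U₂) {S | ∃ F₁ ∈ 𝓒₁, ∃ F₂ ∈ 𝓒₂, S = F₁ ×ˢ F₂})) ∧
        polarO (U₁ ×ˢ U₂)
            (polarC (U₁ ×ˢ U₂) {S | ∃ F₁ ∈ 𝓒₁, ∃ F₂ ∈ 𝓒₂, S = F₁ ×ˢ F₂}) =
          polarO (U₁ ×ˢ U₂) (polarC (U₁ ×ˢ U₂)
            (polarO (U₁ ×ˢ U₂)
              (polarC (U₁ ×ˢ U₂) {S | ∃ F₁ ∈ 𝓒₁, ∃ F₂ ∈ 𝓒₂, S = F₁ ×ˢ F₂})))) := by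
  refine ⟨fun C₁ C₂ _ _ ε _ => uEnl_prod U₁ U₂ C₁ C₂ ε, ?_⟩
  intro 𝓒₁ 𝓒₂ hc₁ hp₁ hu₁ hc₂ hp₂ hu₂
  set 𝓢 : Set (Set (X × Y)) := {S | ∃ F₁ ∈ 𝓒₁, ∃ F₂ ∈ 𝓒₂, S = F₁ ×ˢ F₂} with h𝓢
  have hs₁ : ∀ F ∈ 𝓒₁, F ⊆ U₁ := by
    intro F hF
    obtain ⟨G, _, rfl⟩ := hc₁ F hF
    exact inter_subset_right
  have hs₂ : ∀ F ∈ 𝓒₂, F ⊆ U₂ := by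
    intro F hF
    obtain ⟨G, _, rfl⟩ := hc₂ F hF
    exact inter_subset_right
  refine ⟨fun F hF => hF.1, ?_, ?_⟩
  · intro C hC
    have hCU : C ⊆ U₁ ×ˢ U₂ := by
      obtain ⟨G, _, h⟩ := hC.1
      rw [h]; exact inter_subset_right
    have m₁ : closureIn U₁ (Prod.fst '' C) ∈ 𝓒₁ := by
      rw [hp₁]
      refine proj_mem Prod.fst (fun z w => by rw [Prod.dist_eq]; exact le_max_left _ _)
        (U₁ ×ˢ U₂) (hU₁.prod hU₂) U₁ hU₁ (fun z hz => hz.1) 𝓢 𝓒₁ hs₁ ?_ C hC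
      rintro S ⟨F₁, hF₁, F₂, hF₂, rfl⟩
      exact ⟨F₁, hF₁, fun z hz => hz.1⟩
    have m₂ : closureIn U₂ (Prod.snd '' C) ∈ 𝓒₂ := by
      rw [hp₂]
      refine proj_mem Prod.snd (fun z w => by rw [Prod.dist_eq]; exact le_max_right _ _)
        (U₁ ×ˢ U₂) (hU₁.prod hU₂) U₂ hU₂ (fun z hz => hz.2) 𝓢 𝓒₂ hs₂ ?_ C hC
      rintro S ⟨F₁, hF₁, F₂, hF₂, rfl⟩
      exact ⟨F₂, hF₂, fun z hz => hz.2⟩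
    obtain ⟨ε₁, hε₁, he₁⟩ := hu₁ _ m₁
    obtain ⟨ε₂, hε₂, he₂⟩ := hu₂ _ m₂
    refine ⟨min ε₁ ε₂, lt_min hε₁ hε₂, uEnl_closedIn _ (hU₁.prod hU₂) C hC.1 _, ?_⟩
    intro W hW
    have hsub : C ⊆ closureIn U₁ (Prod.fst '' C) ×ˢ closureIn U₂ (Prod.snd '' C) := fun z hz =>
      ⟨⟨subset_closure (mem_image_of_mem _ hz), (hCU hz).1⟩,
        ⟨subset_closure (mem_image_of_mem _ hz), (hCU hz).2⟩⟩
    have hsub2 := ((uEnl_mono (U := U₁ ×ˢ U₂) hsub (le_refl (min ε₁ ε₂))).trans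
      (uEnl_prod _ _ _ _ _)).trans
      (prod_mono (uEnl_mono (subset_refl _) (min_le_left ε₁ ε₂))
        (uEnl_mono (subset_refl _) (min_le_right ε₁ ε₂)))
    refine rc_mono (closureIn_mono ?_) (hW.2 _ ⟨_, he₁, _, he₂, rfl⟩)
    exact fun z hz => ⟨hz.2, hsub2 hz.1⟩
  · apply Subset.antisymm
    · intro C hC
      refine ⟨hC.1, fun W hW => ?_⟩
      rw [inter_comm]
      exact hW.2 C hC
    · intro C hC
      refine ⟨hC.1, fun W hW => hC.2 W ⟨hW.1, fun D hD => ?_⟩⟩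
      rw [inter_comm]
      exact hD.2 W hW
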